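/- The set {v₁, v₂, v₃, v₄} is a basis of ℝ⁴ contained in the unit sphere of ℓ∞⁴; the functionals v₁*(x) = (x(1)+x(2))/2, v₂*(x) = (x(3)−x(2))/2, v₃*(x) = (x(4)−x(3))/2, v₄*(x) = (x(1)−x(4))/2 have norm 1 on ℓ∞⁴ and are the biorthogonal functionals of this basis (v_i*(v_j) = 1 if i = j and 0 otherwise); hence every x ∈ ℝ⁴ satisfies x = ((x(1)+x(2))/2)·v₁ + ((x(3)−x(2))/2)·v₂ + ((x(4)−x(3))/2)·v₃ + ((x(1)−x(4))/2)·v₄. -/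

import Mathlib

/-- The vectors `v₁, v₂, v₃, v₄` (0-indexed) in `ℓ∞⁴ = (Fin 4 → ℝ, sup norm)`. -/
def v4 : Fin 4 → (Fin 4 → ℝ) :=
  ![![1, 1, 1, 1], ![1, -1, 1, 1], ![1, -1, -1, 1], ![1, -1, -1, -1]]

/-- The biorthogonal functionals `v₁*, v₂*, v₃*, v₄*` on `ℓ∞⁴`:
`v₁*(x) = (x(1)+x(2))/2`, `v₂*(x) = (x(3)−x(2))/2`, `v₃*(x) = (x(4)−x(3))/2`,
`v₄*(x) = (x(1)−x(4))/2` (0-indexed coordinates). -/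
noncomputable def vstar : Fin 4 → ((Fin 4 → ℝ) →L[ℝ] ℝ) :=
  ![(1 / 2 : ℝ) • (ContinuousLinearMap.proj (R := ℝ) (φ := fun _ : Fin 4 => ℝ) 0 +
      ContinuousLinearMap.proj 1),
    (1 / 2 : ℝ) • (ContinuousLinearMap.proj (R := ℝ) (φ := fun _ : Fin 4 => ℝ) 2 -
      ContinuousLinearMap.proj 1),
    (1 / 2 : ℝ) • (ContinuousLinearMap.proj (R := ℝ) (φ := fun _ : Fin 4 => ℝ) 3 -
      ContinuousLinearMap.proj 2),
    (1 / 2 : ℝ) • (ContinuousLinearMap.proj (R := ℝ) (φ := fun _ : Fin 4 => ℝ) 0 -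
      ContinuousLinearMap.proj 3)]

lemma vstar_apply_v4 (i j : Fin 4) : vstar i (v4 j) = if i = j then 1 else 0 := by
  fin_cases i <;> fin_cases j <;> simp [vstar, v4] <;> norm_num

lemma eq_sum_smul_v4 (x : Fin 4 → ℝ) :
    x = ((x 0 + x 1) / 2) • v4 0 + ((x 2 - x 1) / 2) • v4 1 +
        ((x 3 - x 2) / 2) • v4 2 + ((x 0 - x 3) / 2) • v4 3 := by
  ext k
  fin_cases k <;> simp [v4] <;> ring

lemma norm_v4 (i : Fin 4) : ‖v4 i‖ = 1 := by
  have h (k : Fin 4) : ‖v4 i k‖ = 1 := by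
    fin_cases i <;> fin_cases k <;> simp [v4]
  exact le_antisymm ((pi_norm_le_iff_of_nonneg zero_le_one).2 fun k => (h k).le)
    ((h 0).symm.le.trans (norm_le_pi_norm (v4 i) 0))

lemma norm_vstar (i : Fin 4) : ‖vstar i‖ = 1 := by
  apply le_antisymm
  · refine (vstar i).opNorm_le_bound zero_le_one fun x => ?_
    have h (k : Fin 4) := abs_le.1 (norm_le_pi_norm x k)
    have h0 := h 0
    have h1 := h 1
    have h2 := h 2
    have h3 := h 3
    rw [Real.norm_eq_abs, one_mul, abs_le]
    fin_cases i <;> simp [vstar] <;> constructor <;> linarith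
  · simpa [vstar_apply_v4, norm_v4] using (vstar i).le_opNorm (v4 i)

lemma linearIndependent_v4 : LinearIndependent ℝ v4 := by
  rw [Fintype.linearIndependent_iff]
  intro g hg i
  simpa [vstar_apply_v4] using congrArg (vstar i) hg

lemma span_range_v4 : Submodule.span ℝ (Set.range v4) = ⊤ := by
  refine eq_top_iff.2 fun x _ => ?_
  have h (c : ℝ) (i : Fin 4) : c • v4 i ∈ Submodule.span ℝ (Set.range v4) :=
    Submodule.smul_mem _ c (Submodule.subset_span ⟨i, rfl⟩)
  rw [eq_sum_smul_v4 x]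
  exact add_mem (add_mem (add_mem (h _ 0) (h _ 1)) (h _ 2)) (h _ 3)

/-- `{v₁, v₂, v₃, v₄}` is a basis of `ℝ⁴` contained in the unit sphere of `ℓ∞⁴`; the
functionals `v_i*` have norm one and are biorthogonal to this basis; hence every `x`
has the stated expansion. -/
theorem stmt7 :
    LinearIndependent ℝ v4 ∧ Submodule.span ℝ (Set.range v4) = ⊤ ∧
    (∀ i, ‖v4 i‖ = 1) ∧
    (∀ i, ‖vstar i‖ = 1) ∧
    (∀ i j, vstar i (v4 j) = if i = j then 1 else 0) ∧
    (∀ x : Fin 4 → ℝ,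
      x = ((x 0 + x 1) / 2) • v4 0 + ((x 2 - x 1) / 2) • v4 1 +
          ((x 3 - x 2) / 2) • v4 2 + ((x 0 - x 3) / 2) • v4 3) :=
  ⟨linearIndependent_v4, span_range_v4, norm_v4, norm_vstar, vstar_apply_v4, eq_sum_smul_v4⟩
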